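/- arXiv:1909.11080 — 2 statements merged into one kernel-verified Lean document; each statement's English description precedes it below -/
import Mathlib

section
/- For the ERGM(β⃗) on 𝒢_n (any β_1,…,β_s > 0), under the grand coupling of the Glauber dynamics, for any two configurations x, y ∈ 𝒢_n and every integer t ≥ 0: 𝔼[d_H(Z^x(t), Z^y(t))] ≤ (1 − (1 − ‖L‖_1)/M)^t · d_H(x,y), where Z^x(t), Z^y(t) are the coupled Glauber chains started from x and y. -/
open Finset MeasureTheory Filter
open scoped ENNReal NNReal

namespace ERGM

/-- The set of edges of the complete graph on `Fin n`: non-diagonal unordered pairs. -/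
abbrev EdgeSet (n : ℕ) : Type := {p : Sym2 (Fin n) // ¬ p.IsDiag}

/-- A configuration (graph on `n` vertices): an assignment of `true/false` to each edge. -/
abbrev Config (n : ℕ) : Type := EdgeSet n → Bool

/-- The value of the configuration `x` on the (unordered) pair `{i,j}`; `false` for `i = j`. -/
noncomputable def edgeVal {n : ℕ} (x : Config n) (i j : Fin n) : Bool :=
  if h : (s(i, j) : Sym2 (Fin n)).IsDiag then false else x ⟨s(i, j), h⟩

/-- Real-valued indicator of presence of the edge `{i,j}` in `x`. -/
noncomputable def edgeInd {n : ℕ} (x : Config n) (i j : Fin n) : ℝ :=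
  if edgeVal x i j = true then 1 else 0

open scoped Classical in
/-- Subgraph counting number `N_G(x)`: the number of copies of `G` in `x` (times the
number of automorphisms), i.e. the sum over injective `ψ` of the product of edge
indicators (each edge indicator is idempotent, so counting ordered adjacent pairs
yields the same value as counting edges). -/
noncomputable def NG {n m : ℕ} (G : SimpleGraph (Fin m)) (x : Config n) : ℝ :=
  ∑ ψ : Fin m ↪ Fin n, ∏ a : Fin m, ∏ b : Fin m,
    if G.Adj a b then edgeInd x (ψ a) (ψ b) else 1

/-- The Hamiltonian `H(x) = Σ_i β_i N_{G_i}(x) / n^{|V_i|-2}`. -/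
noncomputable def Hamiltonian {n s : ℕ} (V : Fin s → ℕ)
    (G : ∀ i, SimpleGraph (Fin (V i))) (β : Fin s → ℝ) (x : Config n) : ℝ :=
  ∑ i, β i * NG (G i) x / (n : ℝ) ^ (V i - 2)

/-- The ERGM probability mass function `π(x) ∝ exp(H(x))`. -/
noncomputable def ergmProb {n s : ℕ} (V : Fin s → ℕ)
    (G : ∀ i, SimpleGraph (Fin (V i))) (β : Fin s → ℝ) (x : Config n) : ℝ :=
  Real.exp (Hamiltonian V G β x) / ∑ y : Config n, Real.exp (Hamiltonian V G β y)

/-- Expectation of `f` with respect to the mass function `w`. -/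
noncomputable def expect {n : ℕ} (w : Config n → ℝ) (f : Config n → ℝ) : ℝ :=
  ∑ x : Config n, w x * f x

open scoped Classical in
/-- Probability of the event `A` with respect to the mass function `w`. -/
noncomputable def prob {n : ℕ} (w : Config n → ℝ) (A : Config n → Prop) : ℝ :=
  ∑ x : Config n, if A x then w x else 0

/-- The number of edges `|E(G)|` of a finite graph. -/
noncomputable def numEdges {m : ℕ} (G : SimpleGraph (Fin m)) : ℕ := G.edgeSet.ncard

/-- `Ψ_β(p) = Σ_i 2 β_i |E_i| p^{|E_i|-1}`. -/
noncomputable def Psi {s : ℕ} (V : Fin s → ℕ) (G : ∀ i, SimpleGraph (Fin (V i)))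
    (β : Fin s → ℝ) (p : ℝ) : ℝ :=
  ∑ i, 2 * β i * (numEdges (G i) : ℝ) * p ^ (numEdges (G i) - 1)

/-- `Φ(u) = e^u / (1 + e^u)`. -/
noncomputable def Phi (u : ℝ) : ℝ := Real.exp u / (1 + Real.exp u)

/-- `φ_β(p) = Φ(Ψ_β(p))`. -/
noncomputable def phiFn {s : ℕ} (V : Fin s → ℕ) (G : ∀ i, SimpleGraph (Fin (V i)))
    (β : Fin s → ℝ) : ℝ → ℝ := fun p => Phi (Psi V G β p)

/-- `β` is sub-critical (high temperature) with fixed point `p`: `p` is the unique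
solution of `φ_β(p) = p` and it satisfies `φ_β'(p) < 1`. -/
def Subcritical {s : ℕ} (V : Fin s → ℕ) (G : ∀ i, SimpleGraph (Fin (V i)))
    (β : Fin s → ℝ) (p : ℝ) : Prop :=
  phiFn V G β p = p ∧ (∀ q : ℝ, phiFn V G β q = q → q = p) ∧
    deriv (phiFn V G β) p < 1

/-- The discrete derivative `∂_e H(x) = H(x_{e+}) - H(x_{e-})`. -/
noncomputable def dHam {n s : ℕ} (V : Fin s → ℕ) (G : ∀ i, SimpleGraph (Fin (V i)))
    (β : Fin s → ℝ) (e : EdgeSet n) (x : Config n) : ℝ :=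
  Hamiltonian V G β (Function.update x e true) - Hamiltonian V G β (Function.update x e false)

/-- Real-valued indicator `X_e` of presence of edge `e`. -/
noncomputable def edgeX {n : ℕ} (e : EdgeSet n) (x : Config n) : ℝ := if x e = true then 1 else 0

/-- Two edges of `K_n` share a vertex. -/
def ShareVertex {n : ℕ} (e f : EdgeSet n) : Prop := ∃ v : Fin n, v ∈ e.1 ∧ v ∈ f.1


instance (n : ℕ) : MeasurableSpace (EdgeSet n) := ⊤

open scoped Classical in
/-- One step of the grand coupling driven by the seed `ω = (I, U)`: the coordinate `I`
of `x` is set to `1` iff `U ≤ Φ(∂_I H(x))`. -/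
noncomputable def gcStep {n s : ℕ} (V : Fin s → ℕ) (G : ∀ i, SimpleGraph (Fin (V i)))
    (β : Fin s → ℝ) (ω : EdgeSet n × ℝ) (x : Config n) : Config n :=
  Function.update x ω.1 (if ω.2 ≤ Phi (dHam V G β ω.1 x) then true else false)

/-- `t` steps of the grand coupling driven by the seeds `ω : Fin t → EdgeSet n × ℝ`. -/
noncomputable def gcRun {n s : ℕ} (V : Fin s → ℕ) (G : ∀ i, SimpleGraph (Fin (V i)))
    (β : Fin s → ℝ) : (t : ℕ) → (Fin t → EdgeSet n × ℝ) → Config n → Config n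
  | 0, _, x => x
  | t + 1, ω, x =>
      gcStep V G β (ω (Fin.last t)) (gcRun V G β t (fun i => ω i.castSucc) x)

/-- The law of one seed of the grand coupling: a uniformly chosen edge `I` together
with an independent uniform variable `U` on `[0,1]`. -/
noncomputable def seed (n : ℕ) : Measure (EdgeSet n × ℝ) :=
  ((Fintype.card (EdgeSet n) : ℝ≥0∞)⁻¹ • (Measure.count : Measure (EdgeSet n))).prod
    (volume.restrict (Set.Ioc (0 : ℝ) 1))

/-- The law of `t` independent seeds of the grand coupling. -/
noncomputable def seeds (n t : ℕ) : Measure (Fin t → EdgeSet n × ℝ) :=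
  Measure.pi fun _ => seed n

open scoped Classical in
/-- `N_G(x,e,f)`: the number of injective `ψ` mapping all edges of `G` to edges present
in `x_{ef,+}`, with one edge of `G` mapping onto `e` and another onto `f`
(by convention `N_G(x,e,e) = 0`). -/
noncomputable def NGef {n m : ℕ} (G : SimpleGraph (Fin m)) (x : Config n)
    (e f : EdgeSet n) : ℝ :=
  if e = f then 0 else
    ∑ ψ : Fin m ↪ Fin n,
      if (∀ a b : Fin m, G.Adj a b →
            edgeVal (Function.update (Function.update x e true) f true) (ψ a) (ψ b) = true) ∧
         (∃ a b : Fin m, G.Adj a b ∧ (s(ψ a, ψ b) : Sym2 (Fin n)) = e.1) ∧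
         (∃ a b : Fin m, G.Adj a b ∧ (s(ψ a, ψ b) : Sym2 (Fin n)) = f.1) then 1 else 0

/-- The matrix `L` with `L_{ef} = (1/4) Σ_i β_i N_{G_i}(K_n,e,f) / n^{|V_i|-2}`. -/
noncomputable def Lmat {n s : ℕ} (V : Fin s → ℕ) (G : ∀ i, SimpleGraph (Fin (V i)))
    (β : Fin s → ℝ) (e f : EdgeSet n) : ℝ :=
  (1 / 4) * ∑ i, β i * NGef (G i) (fun _ => true) e f / (n : ℝ) ^ (V i - 2)

/-- The `ℓ¹ → ℓ¹` operator norm of a matrix: the maximal column sum of absolute values. -/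
noncomputable def colNorm {n : ℕ} (K : EdgeSet n → EdgeSet n → ℝ) : ℝ :=
  ⨆ f : EdgeSet n, ∑ e : EdgeSet n, |K e f|

/-- The map `ψ` sends some edge of `G` onto the edge `e` of the complete graph. -/
def Covers {n m : ℕ} (G : SimpleGraph (Fin m)) (ψ : Fin m ↪ Fin n) (e : EdgeSet n) : Prop :=
  ∃ a b : Fin m, G.Adj a b ∧ (s(ψ a, ψ b) : Sym2 (Fin n)) = e.1

/-- All the edges of the image of `G` under `ψ` are present in `x`. -/
def IsCopy {n m : ℕ} (G : SimpleGraph (Fin m)) (ψ : Fin m ↪ Fin n) (x : Config n) : Prop :=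
  ∀ e, Covers G ψ e → x e = true

lemma not_isDiag_map {n m : ℕ} {G : SimpleGraph (Fin m)} (ψ : Fin m ↪ Fin n) {a b : Fin m}
    (h : G.Adj a b) : ¬ (s(ψ a, ψ b) : Sym2 (Fin n)).IsDiag := by
  simpa using h.ne

lemma isCopy_iff_edgeVal {n m : ℕ} {G : SimpleGraph (Fin m)} {ψ : Fin m ↪ Fin n} {x : Config n} :
    IsCopy G ψ x ↔ ∀ a b, G.Adj a b → edgeVal x (ψ a) (ψ b) = true := by
  constructor
  · intro h a b hab
    rw [edgeVal, dif_neg (not_isDiag_map ψ hab)]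
    exact h _ ⟨a, b, hab, rfl⟩
  · rintro h ⟨_, he⟩ ⟨a, b, hab, rfl⟩
    have := h a b hab
    rwa [edgeVal, dif_neg he] at this

open scoped Classical in
lemma NG_eq_sum_isCopy {n m : ℕ} (G : SimpleGraph (Fin m)) (x : Config n) :
    NG G x = ∑ ψ : Fin m ↪ Fin n, if IsCopy G ψ x then (1 : ℝ) else 0 := by
  refine Finset.sum_congr rfl fun ψ _ => ?_
  split_ifs with h
  · rw [isCopy_iff_edgeVal] at h
    refine Finset.prod_eq_one fun a _ => Finset.prod_eq_one fun b _ => ?_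
    split_ifs with hab
    · simp [edgeInd, h a b hab]
    · rfl
  · rw [isCopy_iff_edgeVal] at h
    push Not at h
    obtain ⟨a, b, hab, hx⟩ := h
    refine Finset.prod_eq_zero (Finset.mem_univ a) (Finset.prod_eq_zero (Finset.mem_univ b) ?_)
    simp [hab, edgeInd, hx]

open scoped Classical in
lemma NGef_complete {n m : ℕ} (G : SimpleGraph (Fin m)) (e f : EdgeSet n) :
    NGef G (fun _ => true) e f =
      ∑ ψ : Fin m ↪ Fin n, if e ≠ f ∧ Covers G ψ e ∧ Covers G ψ f then (1 : ℝ) else 0 := by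
  have hupd : Function.update (Function.update (fun _ : EdgeSet n => true) e true) f true
      = fun _ => true := by
    ext g; simp [Function.update_apply]
  by_cases hef : e = f
  · simp [NGef, hef]
  · rw [NGef, if_neg hef]
    refine Finset.sum_congr rfl fun ψ _ => ?_
    rw [hupd]
    refine if_congr ?_ rfl rfl
    have : ∀ a b, G.Adj a b → edgeVal (fun _ : EdgeSet n => true) (ψ a) (ψ b) = true :=
      isCopy_iff_edgeVal.1 fun _ _ => rfl
    exact ⟨fun h => ⟨hef, h.2⟩, fun h => ⟨this, h.2⟩⟩

lemma isCopy_update_of_not_covers {n m : ℕ} {G : SimpleGraph (Fin m)} {ψ : Fin m ↪ Fin n}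
    {e : EdgeSet n} (he : ¬ Covers G ψ e) (x : Config n) (v : Bool) :
    IsCopy G ψ (Function.update x e v) ↔ IsCopy G ψ x := by
  refine forall₂_congr fun g hg => ?_
  rw [Function.update_of_ne (ne_of_mem_of_not_mem (s := {g | Covers G ψ g}) hg he)]

lemma isCopy_update_congr {n m : ℕ} {G : SimpleGraph (Fin m)} {ψ : Fin m ↪ Fin n}
    {e : EdgeSet n} {x y : Config n} (h : ∀ f, f ≠ e → Covers G ψ f → x f = y f) (v : Bool) :
    IsCopy G ψ (Function.update x e v) ↔ IsCopy G ψ (Function.update y e v) := by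
  refine forall₂_congr fun g hg => ?_
  by_cases hge : g = e
  · subst hge; simp
  · simp [hge, h g hge hg]

lemma isCopy_update_mono {n m : ℕ} {G : SimpleGraph (Fin m)} {ψ : Fin m ↪ Fin n}
    {e : EdgeSet n} {x : Config n} (h : IsCopy G ψ (Function.update x e false)) :
    IsCopy G ψ (Function.update x e true) := by
  intro g hg
  by_cases hge : g = e
  · subst hge; simp
  · simpa [hge] using h g hg

open scoped Classical in
/-- The discrete derivative of the indicator that `ψ` embeds `G` depends on the configuration
only through the edges covered by `ψ`. -/
lemma abs_isCopy_deriv_sub_le {n m : ℕ} (G : SimpleGraph (Fin m)) (ψ : Fin m ↪ Fin n)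
    (e : EdgeSet n) (x y : Config n) :
    |((if IsCopy G ψ (Function.update x e true) then (1 : ℝ) else 0)
        - if IsCopy G ψ (Function.update x e false) then (1 : ℝ) else 0)
      - ((if IsCopy G ψ (Function.update y e true) then (1 : ℝ) else 0)
        - if IsCopy G ψ (Function.update y e false) then (1 : ℝ) else 0)| ≤
      ∑ f, (if x f ≠ y f then (1 : ℝ) else 0) *
        if e ≠ f ∧ Covers G ψ e ∧ Covers G ψ f then (1 : ℝ) else 0 := by
  have hnn : ∀ f ∈ (Finset.univ : Finset (EdgeSet n)), 0 ≤ (if x f ≠ y f then (1 : ℝ) else 0) *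
      if e ≠ f ∧ Covers G ψ e ∧ Covers G ψ f then (1 : ℝ) else 0 := fun f _ => by positivity
  by_cases he : Covers G ψ e
  swap
  · simpa [isCopy_update_of_not_covers he] using Finset.sum_nonneg hnn
  by_cases hf : ∃ f, f ≠ e ∧ Covers G ψ f ∧ x f ≠ y f
  · obtain ⟨f, hfe, hf, hxy⟩ := hf
    refine le_trans ?_ (Finset.single_le_sum hnn (Finset.mem_univ f))
    have hcov : e ≠ f ∧ Covers G ψ e ∧ Covers G ψ f := ⟨hfe.symm, he, hf⟩
    rw [if_pos hxy, if_pos hcov]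
    have hx := isCopy_update_mono (G := G) (ψ := ψ) (e := e) (x := x)
    have hy := isCopy_update_mono (G := G) (ψ := ψ) (e := e) (x := y)
    split_ifs <;> first | (exfalso; tauto) | norm_num
  · push Not at hf
    simpa [isCopy_update_congr hf] using Finset.sum_nonneg hnn

lemma NGef_nonneg {n m : ℕ} (G : SimpleGraph (Fin m)) (e f : EdgeSet n) :
    0 ≤ NGef G (fun _ => true) e f := by
  classical
  rw [NGef_complete]
  positivity

lemma Lmat_nonneg {n s : ℕ} (V : Fin s → ℕ) (G : ∀ i, SimpleGraph (Fin (V i)))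
    (β : Fin s → ℝ) (hβ : ∀ i, 0 < β i) (e f : EdgeSet n) : 0 ≤ Lmat V G β e f :=
  mul_nonneg (by norm_num) <| Finset.sum_nonneg fun i _ =>
    div_nonneg (mul_nonneg (hβ i).le (NGef_nonneg _ _ _)) (by positivity)

lemma abs_NG_deriv_sub_le {n m : ℕ} (G : SimpleGraph (Fin m)) (e : EdgeSet n) (x y : Config n) :
    |(NG G (Function.update x e true) - NG G (Function.update x e false))
      - (NG G (Function.update y e true) - NG G (Function.update y e false))| ≤
      ∑ f, (if x f ≠ y f then (1 : ℝ) else 0) * NGef G (fun _ => true) e f := by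
  classical
  simp only [NG_eq_sum_isCopy, NGef_complete, ← Finset.sum_sub_distrib, Finset.mul_sum]
  rw [Finset.sum_comm]
  exact (Finset.abs_sum_le_sum_abs _ _).trans
    (Finset.sum_le_sum fun ψ _ => abs_isCopy_deriv_sub_le G ψ e x y)

lemma abs_dHam_sub_le {n s : ℕ} (V : Fin s → ℕ) (G : ∀ i, SimpleGraph (Fin (V i)))
    (β : Fin s → ℝ) (hβ : ∀ i, 0 < β i) (e : EdgeSet n) (x y : Config n) :
    |dHam V G β e x - dHam V G β e y| ≤
      4 * ∑ f, (if x f ≠ y f then (1 : ℝ) else 0) * Lmat V G β e f := by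
  have hR : 4 * ∑ f, (if x f ≠ y f then (1 : ℝ) else 0) * Lmat V G β e f =
      ∑ i, β i / (n : ℝ) ^ (V i - 2) *
        ∑ f, (if x f ≠ y f then (1 : ℝ) else 0) * NGef (G i) (fun _ => true) e f := by
    simp only [Lmat, Finset.mul_sum]
    rw [Finset.sum_comm]
    exact Finset.sum_congr rfl fun i _ => Finset.sum_congr rfl fun f _ => by ring
  have hL : dHam V G β e x - dHam V G β e y =
      ∑ i, β i / (n : ℝ) ^ (V i - 2) *
        ((NG (G i) (Function.update x e true) - NG (G i) (Function.update x e false))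
        - (NG (G i) (Function.update y e true) - NG (G i) (Function.update y e false))) := by
    simp only [dHam, Hamiltonian, ← Finset.sum_sub_distrib]
    exact Finset.sum_congr rfl fun i _ => by ring
  rw [hR, hL]
  refine (Finset.abs_sum_le_sum_abs _ _).trans (Finset.sum_le_sum fun i _ => ?_)
  have hc : 0 ≤ β i / (n : ℝ) ^ (V i - 2) := div_nonneg (hβ i).le (by positivity)
  rw [abs_mul, abs_of_nonneg hc]
  exact mul_le_mul_of_nonneg_left (abs_NG_deriv_sub_le _ _ _ _) hc

lemma Phi_eq_sigmoid : Phi = Real.sigmoid := by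
  ext u
  rw [Phi, Real.sigmoid, Real.exp_neg]
  field_simp
  ring

lemma abs_Phi_sub_le (u v : ℝ) : |Phi u - Phi v| ≤ 1 / 4 * |u - v| := by
  rw [Phi_eq_sigmoid]
  have := Convex.norm_image_sub_le_of_norm_deriv_le (f := Real.sigmoid) (s := Set.univ)
    (C := 1 / 4) (x := v) (y := u) (fun z _ => differentiableAt_sigmoid)
    (fun z _ => ?_) convex_univ (Set.mem_univ _) (Set.mem_univ _)
  · simpa [Real.norm_eq_abs] using this
  · rw [Real.deriv_sigmoid, Real.norm_eq_abs, abs_of_nonneg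
      (mul_nonneg (Real.sigmoid_nonneg z) (sub_nonneg.2 (Real.sigmoid_le_one z)))]
    nlinarith [sq_nonneg (Real.sigmoid z - 1 / 2)]

/-- The probability that the heat-bath update at `e` separates `x` and `y`. -/
lemma abs_Phi_dHam_sub_le {n s : ℕ} (V : Fin s → ℕ) (G : ∀ i, SimpleGraph (Fin (V i)))
    (β : Fin s → ℝ) (hβ : ∀ i, 0 < β i) (e : EdgeSet n) (x y : Config n) :
    |Phi (dHam V G β e x) - Phi (dHam V G β e y)| ≤
      ∑ f, (if x f ≠ y f then (1 : ℝ) else 0) * Lmat V G β e f := by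
  linarith [abs_Phi_sub_le (dHam V G β e x) (dHam V G β e y), abs_dHam_sub_le V G β hβ e x y]

lemma hammingDist_eq_sum {n : ℕ} (x y : Config n) :
    (hammingDist x y : ℝ) = ∑ f, if x f ≠ y f then (1 : ℝ) else 0 := by
  rw [hammingDist, Finset.sum_boole]

lemma hammingDist_update {n : ℕ} (x y : Config n) (e : EdgeSet n) (a b : Bool) :
    (hammingDist (Function.update x e a) (Function.update y e b) : ℝ) =
      hammingDist x y - (if x e ≠ y e then (1 : ℝ) else 0) + if a ≠ b then (1 : ℝ) else 0 := by
  rw [hammingDist_eq_sum, hammingDist_eq_sum, ← Finset.add_sum_erase _ _ (Finset.mem_univ e),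
    ← Finset.add_sum_erase _ (fun f => if x f ≠ y f then (1 : ℝ) else 0) (Finset.mem_univ e)]
  rw [Finset.sum_congr rfl (g := fun f => if x f ≠ y f then (1 : ℝ) else 0)]
  · simp only [Function.update_self]
    ring
  · intro f hf
    simp [(Finset.mem_erase.1 hf).1]

open scoped Classical in
lemma integral_threshold_ne_le (p q : ℝ) :
    ∫ u in Set.Ioc (0 : ℝ) 1,
      (if (if u ≤ p then true else false) ≠ (if u ≤ q then true else false) then (1 : ℝ) else 0)
      ≤ |p - q| := by
  have h : (fun u : ℝ => if (if u ≤ p then true else false) ≠ (if u ≤ q then true else false)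
      then (1 : ℝ) else 0) = (Set.Ioc (min p q) (max p q)).indicator 1 := by
    ext u
    simp only [Set.indicator, Set.mem_Ioc, min_lt_iff, le_max_iff, Pi.one_apply]
    refine if_congr ?_ rfl rfl
    by_cases hp : u ≤ p <;> by_cases hq : u ≤ q <;> simp [hp, hq] <;> grind
  rw [h, integral_indicator_one measurableSet_Ioc]
  calc (volume.restrict (Set.Ioc (0 : ℝ) 1)).real (Set.Ioc (min p q) (max p q))
      ≤ volume.real (Set.Ioc (min p q) (max p q)) :=
        ENNReal.toReal_mono (by simp) (Measure.restrict_apply_le _ _)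
    _ = |p - q| := by
        rw [Real.volume_real_Ioc_of_le min_le_max, max_sub_min_eq_abs, abs_sub_comm]

instance (n : ℕ) : DiscreteMeasurableSpace (EdgeSet n) := ⟨fun _ => trivial⟩

lemma measurable_gcStep {n s : ℕ} (V : Fin s → ℕ) (G : ∀ i, SimpleGraph (Fin (V i)))
    (β : Fin s → ℝ) :
    Measurable fun p : (EdgeSet n × ℝ) × Config n => gcStep V G β p.1 p.2 := by
  refine measurable_from_prod_countable_left fun x =>
    measurable_from_prod_countable_right fun e => ?_
  refine (Measurable.of_discrete (f := Function.update x e)).comp ?_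
  exact Measurable.ite (measurableSet_Iic (a := Phi (dHam V G β e x)))
    measurable_const measurable_const

lemma measurable_gcRun {n s : ℕ} (V : Fin s → ℕ) (G : ∀ i, SimpleGraph (Fin (V i)))
    (β : Fin s → ℝ) (x : Config n) (t : ℕ) :
    Measurable fun ω : Fin t → EdgeSet n × ℝ => gcRun V G β t ω x := by
  induction t with
  | zero => exact measurable_const
  | succ t ih =>
    have hinit : Measurable fun (ω : Fin (t + 1) → EdgeSet n × ℝ) (i : Fin t) => ω i.castSucc :=
      measurable_pi_lambda _ fun _ => measurable_pi_apply _
    exact (measurable_gcStep V G β).comp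
      ((measurable_pi_apply (Fin.last t)).prodMk (ih.comp hinit))

/-- The Hamming distance of two random configurations is integrable. -/
lemma integrable_hammingDist {n : ℕ} {Ω : Type*} [MeasurableSpace Ω] {μ : Measure Ω}
    [IsFiniteMeasure μ] {X Y : Ω → Config n} (hX : Measurable X) (hY : Measurable Y) :
    Integrable (fun ω => (hammingDist (X ω) (Y ω) : ℝ)) μ := by
  refine Integrable.of_bound (C := Fintype.card (EdgeSet n)) ?_ (ae_of_all _ fun ω => ?_)
  · exact ((Measurable.of_discrete (f := fun p : Config n × Config n =>
      (hammingDist p.1 p.2 : ℝ))).comp (hX.prodMk hY)).aestronglyMeasurable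
  · rw [Real.norm_natCast]
    exact_mod_cast hammingDist_le_card_fintype

instance (n : ℕ) [Nonempty (EdgeSet n)] : IsFiniteMeasure
    ((Fintype.card (EdgeSet n) : ℝ≥0∞)⁻¹ • (Measure.count : Measure (EdgeSet n))) :=
  Measure.smul_finite _ (ENNReal.inv_ne_top.2 (Nat.cast_ne_zero.2 Fintype.card_ne_zero))

instance (n : ℕ) [Nonempty (EdgeSet n)] : IsFiniteMeasure (seed n) := by
  unfold seed
  infer_instance

instance (n t : ℕ) [Nonempty (EdgeSet n)] : IsFiniteMeasure (seeds n t) := by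
  unfold seeds
  infer_instance

lemma integral_gcStep_le {n s : ℕ} [Nonempty (EdgeSet n)] (V : Fin s → ℕ)
    (G : ∀ i, SimpleGraph (Fin (V i))) (β : Fin s → ℝ) (hβ : ∀ i, 0 < β i) (x y : Config n) :
    ∫ ω, (hammingDist (gcStep V G β ω x) (gcStep V G β ω y) : ℝ) ∂(seed n) ≤
      (1 - (1 - colNorm (fun e f : EdgeSet n => Lmat V G β e f)) /
        (Fintype.card (EdgeSet n) : ℝ)) * hammingDist x y := by
  set M : ℝ := ((Fintype.card (EdgeSet n) : ℕ) : ℝ) with hM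
  have hM0 : 0 < M := Nat.cast_pos.2 Fintype.card_pos
  have hmeas (z : Config n) : Measurable fun ω => gcStep V G β ω z :=
    (measurable_gcStep V G β).comp (measurable_id.prodMk measurable_const)
  have hint := integrable_hammingDist (μ := seed n) (hmeas x) (hmeas y)
  have hstep (e : EdgeSet n) : ∫ u in Set.Ioc (0 : ℝ) 1,
      (hammingDist (gcStep V G β (e, u) x) (gcStep V G β (e, u) y) : ℝ) ≤
      hammingDist x y - (if x e ≠ y e then (1 : ℝ) else 0)
        + ∑ f, (if x f ≠ y f then (1 : ℝ) else 0) * Lmat V G β e f := by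
    simp only [gcStep, hammingDist_update]
    rw [integral_add (integrable_const _)]
    · refine add_le_add (by simp) ?_
      exact (integral_threshold_ne_le _ _).trans (abs_Phi_dHam_sub_le V G β hβ e x y)
    · refine Integrable.of_bound (C := 1) (Measurable.aestronglyMeasurable ?_)
        (ae_of_all _ fun u => ?_)
      · refine (Measurable.of_discrete (f := fun p : Bool × Bool =>
          if p.1 ≠ p.2 then (1 : ℝ) else 0)).comp (Measurable.prodMk ?_ ?_) <;>
        exact Measurable.ite measurableSet_Iic measurable_const measurable_const
      · split_ifs <;> simp
  have hcol (f : EdgeSet n) :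
      ∑ e, Lmat V G β e f ≤ colNorm (fun e f : EdgeSet n => Lmat V G β e f) := by
    refine le_trans (Finset.sum_le_sum fun e _ => le_abs_self _) ?_
    exact le_ciSup (f := fun f => ∑ e, |Lmat V G β e f|) (Set.finite_range _).bddAbove f
  calc ∫ ω, (hammingDist (gcStep V G β ω x) (gcStep V G β ω y) : ℝ) ∂(seed n)
      = M⁻¹ * ∑ e, ∫ u in Set.Ioc (0 : ℝ) 1,
          (hammingDist (gcStep V G β (e, u) x) (gcStep V G β (e, u) y) : ℝ) := by
        rw [seed, integral_prod _ hint, integral_smul_measure, integral_fintype .of_finite]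
        simp only [count_real_singleton, one_mul, smul_eq_mul, ENNReal.toReal_inv,
          ENNReal.toReal_natCast, ← hM]
    _ ≤ M⁻¹ * ∑ e, (hammingDist x y - (if x e ≠ y e then (1 : ℝ) else 0)
          + ∑ f, (if x f ≠ y f then (1 : ℝ) else 0) * Lmat V G β e f) := by
        gcongr with e
        exact hstep e
    _ = M⁻¹ * (M * hammingDist x y - hammingDist x y
          + ∑ f, (if x f ≠ y f then (1 : ℝ) else 0) * ∑ e, Lmat V G β e f) := by
        rw [Finset.sum_add_distrib, Finset.sum_sub_distrib, ← hammingDist_eq_sum,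
          Finset.sum_comm]
        simp [hM, Finset.mul_sum]
    _ ≤ M⁻¹ * (M * hammingDist x y - hammingDist x y
          + ∑ f, (if x f ≠ y f then (1 : ℝ) else 0) *
            colNorm (fun e f : EdgeSet n => Lmat V G β e f)) := by
        gcongr with f
        exact hcol f
    _ = _ := by
        rw [← Finset.sum_mul, ← hammingDist_eq_sum]
        field_simp
        ring

lemma colNorm_nonneg {n : ℕ} (K : EdgeSet n → EdgeSet n → ℝ) : 0 ≤ colNorm K :=
  Real.iSup_nonneg fun _ => Finset.sum_nonneg fun _ _ => abs_nonneg _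

/-- Splitting off the last seed. -/
lemma integral_gcRun_succ {n s : ℕ} [Nonempty (EdgeSet n)] (V : Fin s → ℕ)
    (G : ∀ i, SimpleGraph (Fin (V i))) (β : Fin s → ℝ) (x y : Config n) (t : ℕ) :
    ∫ ω, (hammingDist (gcRun V G β (t + 1) ω x) (gcRun V G β (t + 1) ω y) : ℝ)
        ∂(seeds n (t + 1)) =
      ∫ ω, ∫ w, (hammingDist (gcStep V G β w (gcRun V G β t ω x))
        (gcStep V G β w (gcRun V G β t ω y)) : ℝ) ∂(seed n) ∂(seeds n t) := by
  have hmp := measurePreserving_piFinSuccAbove (fun _ : Fin (t + 1) => seed n) (Fin.last t)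
  have hmeas (z : Config n) : Measurable fun p : (EdgeSet n × ℝ) × (Fin t → EdgeSet n × ℝ) =>
      gcStep V G β p.1 (gcRun V G β t p.2 z) :=
    (measurable_gcStep V G β).comp
      (measurable_fst.prodMk ((measurable_gcRun V G β z t).comp measurable_snd))
  have hint := integrable_hammingDist (μ := (seed n).prod (seeds n t)) (hmeas x) (hmeas y)
  rw [← integral_prod_symm _ hint]
  refine Eq.trans ?_ (hmp.integral_comp' _)
  refine integral_congr_ae (ae_of_all _ fun ω => ?_)
  simp only [gcRun, MeasurableEquiv.piFinSuccAbove, MeasurableEquiv.coe_mk,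
    Fin.insertNthEquiv_last]
  rfl

/-- **(Equation (contraction2): Hamming contraction under the grand coupling).**
For any `β_i > 0`, any two configurations `x, y` and any time `t`,
`𝔼[d_H(Z^x(t), Z^y(t))] ≤ (1 - (1 - ‖L‖₁)/M)^t d_H(x,y)` under the grand coupling. -/
theorem hamming_contraction_grand_coupling {s : ℕ} (V : Fin s → ℕ)
    (G : ∀ i, SimpleGraph (Fin (V i))) (β : Fin s → ℝ) (hβ : ∀ i, 0 < β i) :
    ∀ n : ℕ, ∀ x y : Config n, ∀ t : ℕ,
      (∫ ω : Fin t → EdgeSet n × ℝ,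
          (hammingDist (gcRun V G β t ω x) (gcRun V G β t ω y) : ℝ) ∂(seeds n t)) ≤
        (1 - (1 - colNorm (fun e f : EdgeSet n => Lmat V G β e f)) /
            (Fintype.card (EdgeSet n) : ℝ)) ^ t * (hammingDist x y : ℝ) := by
  intro n x y t
  rcases isEmpty_or_nonempty (EdgeSet n) with hE | hE
  · have h0 (z w : Config n) : hammingDist z w = 0 := by simp [Subsingleton.elim z w]
    simp [h0]
  induction t with
  | zero =>
    simp [seeds, gcRun, Measure.pi_of_empty _ (fun i : Fin 0 => i.elim0)]
  | succ t ih =>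
    set c : ℝ := 1 - (1 - colNorm (fun e f : EdgeSet n => Lmat V G β e f)) /
      (Fintype.card (EdgeSet n) : ℝ) with hc
    have hc0 : 0 ≤ c := by
      have hM : (1 : ℝ) ≤ Fintype.card (EdgeSet n) := by exact_mod_cast Fintype.card_pos
      have := colNorm_nonneg (fun e f : EdgeSet n => Lmat V G β e f)
      rw [hc, sub_nonneg, div_le_one (by linarith)]
      linarith
    rw [integral_gcRun_succ]
    calc _ ≤ ∫ ω, c * (hammingDist (gcRun V G β t ω x) (gcRun V G β t ω y) : ℝ) ∂(seeds n t) :=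
          integral_mono_of_nonneg (ae_of_all _ fun ω => integral_nonneg fun w => by positivity)
            ((integrable_hammingDist (measurable_gcRun V G β x t)
              (measurable_gcRun V G β y t)).const_mul c)
            (ae_of_all _ fun ω => integral_gcStep_le V G β hβ _ _)
      _ ≤ c * (c ^ t * hammingDist x y) := by
          rw [integral_const_mul]
          exact mul_le_mul_of_nonneg_left ih hc0
      _ = _ := by ring

end ERGM
end

section
/- Let β⃗ be sub-critical. There exists a sufficiently small constant δ > 0 such that for all sufficiently large n, for any configurations y ≤ z (coordinatewise) with y, z ∈ T_δ, under the grand coupling of the Glauber dynamics: 𝔼[d_H(Z^y(1), Z^z(1))] ≤ (1 − δ/M) d_H(y,z). -/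
open Finset MeasureTheory Filter
open scoped ENNReal NNReal

namespace ERGM

open scoped Classical in
/-- `N_G(x,e)`: the number of injective `ψ` such that every edge of `G` maps to an edge
present in `x_{e+}` and some edge of `G` maps onto `e`. -/
noncomputable def NGe {n m : ℕ} (G : SimpleGraph (Fin m)) (x : Config n) (e : EdgeSet n) : ℝ :=
  ∑ ψ : Fin m ↪ Fin n,
    if (∀ a b : Fin m, G.Adj a b → edgeVal (Function.update x e true) (ψ a) (ψ b) = true) ∧
       (∃ a b : Fin m, G.Adj a b ∧ (s(ψ a, ψ b) : Sym2 (Fin n)) = e.1) then 1 else 0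

/-- The normalized subgraph counting number
`r_G(x,e) = (N_G(x,e) / (2|E(G)| n^{|V(G)|-2}))^{1/(|E(G)|-1)}`. -/
noncomputable def rG {n m : ℕ} (G : SimpleGraph (Fin m)) (x : Config n) (e : EdgeSet n) : ℝ :=
  (NGe G x e / (2 * (numEdges G : ℝ) * (n : ℝ) ^ (m - 2))) ^
    ((1 : ℝ) / ((numEdges G : ℝ) - 1))

/-- Membership in the set `T_δ`: all normalized subgraph counting numbers `r_G(x,e)`,
over (nondegenerate) graphs `G` with at most `a` vertices and edges `e` of `K_n`,
lie in `(p* - δ, p* + δ)`. -/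
def memT {n : ℕ} (a : ℕ) (pstar δ : ℝ) (x : Config n) : Prop :=
  ∀ m : ℕ, m ≤ a → ∀ G : SimpleGraph (Fin m), 2 ≤ numEdges G →
    ∀ e : EdgeSet n, pstar - δ < rG G x e ∧ rG G x e < pstar + δ

/-- The embedding `ψ` maps every edge of `G` to an edge of `x`. -/
def ContainsCopy {n m : ℕ} (G : SimpleGraph (Fin m)) (x : Config n) (ψ : Fin m ↪ Fin n) : Prop :=
  ∀ g ∈ G.edgeSet, ∃ h : ¬ (g.map ψ).IsDiag, x ⟨g.map ψ, h⟩ = true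

/-- The embedding `ψ` maps some edge of `G` onto `e`. -/
def CoversEdge {n m : ℕ} (G : SimpleGraph (Fin m)) (ψ : Fin m ↪ Fin n) (e : EdgeSet n) : Prop :=
  ∃ g ∈ G.edgeSet, g.map ψ = e.1

lemma edgeVal_eq_true_iff {n : ℕ} (x : Config n) (i j : Fin n) :
    edgeVal x i j = true ↔ ∃ h : ¬ (s(i, j) : Sym2 (Fin n)).IsDiag, x ⟨s(i, j), h⟩ = true := by
  unfold edgeVal
  split_ifs with h
  · simp only [false_iff, not_exists]
    exact fun h' => absurd h h'
  · exact ⟨fun hx => ⟨h, hx⟩, fun ⟨_, hx⟩ => hx⟩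

lemma forall_adj_edgeVal_iff {n m : ℕ} (G : SimpleGraph (Fin m)) (x : Config n)
    (ψ : Fin m ↪ Fin n) :
    (∀ a b : Fin m, G.Adj a b → edgeVal x (ψ a) (ψ b) = true) ↔ ContainsCopy G x ψ := by
  simp only [edgeVal_eq_true_iff, ContainsCopy]
  refine ⟨fun H g => ?_, fun H a b hab => H s(a, b) hab⟩
  induction g using Sym2.ind with
  | _ a b => exact fun hg => H a b hg

lemma exists_adj_eq_iff {n m : ℕ} (G : SimpleGraph (Fin m)) (ψ : Fin m ↪ Fin n) (e : EdgeSet n) :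
    (∃ a b : Fin m, G.Adj a b ∧ (s(ψ a, ψ b) : Sym2 (Fin n)) = e.1) ↔ CoversEdge G ψ e := by
  refine ⟨fun ⟨a, b, hab, he⟩ => ⟨s(a, b), hab, he⟩, ?_⟩
  rintro ⟨g, hg, he⟩
  induction g using Sym2.ind with
  | _ a b => exact ⟨a, b, hg, he⟩

open scoped Classical in
lemma NG_eq_sum {n m : ℕ} (G : SimpleGraph (Fin m)) (x : Config n) :
    NG G x = ∑ ψ : Fin m ↪ Fin n, if ContainsCopy G x ψ then (1 : ℝ) else 0 := by
  refine Finset.sum_congr rfl fun ψ _ => ?_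
  have h (a b : Fin m) : (if G.Adj a b then edgeInd x (ψ a) (ψ b) else 1)
      = if G.Adj a b → edgeVal x (ψ a) (ψ b) = true then (1 : ℝ) else 0 := by
    unfold edgeInd
    by_cases hab : G.Adj a b <;> simp [hab]
  simp only [h, Fintype.prod_boole, ← forall_adj_edgeVal_iff]
  convert Fintype.prod_boole (M₀ := ℝ)
    (p := fun a => ∀ b : Fin m, G.Adj a b → edgeVal x (ψ a) (ψ b) = true)

open scoped Classical in
lemma NGe_eq_sum {n m : ℕ} (G : SimpleGraph (Fin m)) (x : Config n) (e : EdgeSet n) :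
    NGe G x e = ∑ ψ : Fin m ↪ Fin n,
      if ContainsCopy G (Function.update x e true) ψ ∧ CoversEdge G ψ e then (1 : ℝ) else 0 := by
  simp only [NGe, forall_adj_edgeVal_iff, exists_adj_eq_iff]

lemma ContainsCopy.mono {n m : ℕ} {G : SimpleGraph (Fin m)} {x y : Config n}
    {ψ : Fin m ↪ Fin n} (h : ContainsCopy G x ψ) (hxy : ∀ e, x e ≤ y e) :
    ContainsCopy G y ψ := fun g hg => by
  obtain ⟨hd, hx⟩ := h g hg
  exact ⟨hd, Bool.eq_true_of_true_le (hx ▸ hxy _)⟩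

lemma update_true_mono {n : ℕ} {x y : Config n} (hxy : ∀ e, x e ≤ y e) (e f : EdgeSet n) :
    Function.update x e true f ≤ Function.update y e true f := by
  by_cases h : f = e
  · subst h; simp
  · simpa [h] using hxy f

lemma NGe_nonneg {n m : ℕ} (G : SimpleGraph (Fin m)) (x : Config n) (e : EdgeSet n) :
    0 ≤ NGe G x e := by
  classical
  rw [NGe_eq_sum]
  exact Finset.sum_nonneg fun ψ _ => by split_ifs <;> norm_num

lemma NGe_mono {n m : ℕ} (G : SimpleGraph (Fin m)) {x y : Config n} (hxy : ∀ e, x e ≤ y e)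
    (e : EdgeSet n) : NGe G x e ≤ NGe G y e := by
  classical
  rw [NGe_eq_sum, NGe_eq_sum]
  refine Finset.sum_le_sum fun ψ _ => ?_
  by_cases h : ContainsCopy G (Function.update x e true) ψ ∧ CoversEdge G ψ e
  · rw [if_pos h, if_pos ⟨h.1.mono (update_true_mono hxy e), h.2⟩]
  · rw [if_neg h]
    split_ifs <;> norm_num

lemma NG_update_sub {n m : ℕ} (G : SimpleGraph (Fin m)) (x : Config n) (e : EdgeSet n) :
    NG G (Function.update x e true) - NG G (Function.update x e false) = NGe G x e := by
  classical
  rw [NG_eq_sum, NG_eq_sum, NGe_eq_sum, ← Finset.sum_sub_distrib]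
  refine Finset.sum_congr rfl fun ψ _ => ?_
  by_cases hc : CoversEdge G ψ e
  · have : ¬ ContainsCopy G (Function.update x e false) ψ := by
      intro h
      obtain ⟨g, hg, hge⟩ := hc
      obtain ⟨hd, hx⟩ := h g hg
      have : (⟨g.map ψ, hd⟩ : EdgeSet n) = e := Subtype.ext hge
      simp [this] at hx
    simp [this, hc]
  · have : ContainsCopy G (Function.update x e true) ψ ↔
        ContainsCopy G (Function.update x e false) ψ := by
      refine forall₂_congr fun g hg => exists_congr fun hd => ?_
      have : (⟨g.map ψ, hd⟩ : EdgeSet n) ≠ e := fun h => hc ⟨g, hg, congrArg Subtype.val h⟩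
      simp [this]
    simp [this, hc]

lemma dHam_eq_sum {n s : ℕ} (V : Fin s → ℕ) (G : ∀ i, SimpleGraph (Fin (V i)))
    (β : Fin s → ℝ) (e : EdgeSet n) (x : Config n) :
    dHam V G β e x = ∑ i, β i * (NGe (G i) x e / (n : ℝ) ^ (V i - 2)) := by
  rw [dHam, Hamiltonian, Hamiltonian, ← Finset.sum_sub_distrib]
  refine Finset.sum_congr rfl fun i _ => ?_
  rw [← NG_update_sub]
  ring

lemma numEdges_deleteEdges_singleton {m : ℕ} (G : SimpleGraph (Fin m)) {g : Sym2 (Fin m)}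
    (hg : g ∈ G.edgeSet) : numEdges (G.deleteEdges {g}) = numEdges G - 1 := by
  rw [numEdges, SimpleGraph.edgeSet_deleteEdges, numEdges]
  exact Set.ncard_sdiff_singleton_of_mem hg

open scoped Classical in
/-- Adding the edges in which `y ≤ z` differ creates new copies of `G` through an edge `e` only
where some differing edge `f` lies on a copy of `G` with one edge removed. -/
lemma sum_NGe_sub_le {n m : ℕ} (G : SimpleGraph (Fin m)) {y z : Config n}
    (hyz : ∀ e, y e ≤ z e) :
    ∑ e, (NGe G z e - NGe G y e) ≤
      ∑ g ∈ G.edgeSet.toFinset, ∑ f with y f ≠ z f, NGe (G.deleteEdges {g}) z f := by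
  simp only [NGe_eq_sum]
  have hL : ∀ e : EdgeSet n, (∑ ψ : Fin m ↪ Fin n,
      (if ContainsCopy G (Function.update z e true) ψ ∧ CoversEdge G ψ e then (1 : ℝ) else 0)) -
      (∑ ψ : Fin m ↪ Fin n,
      if ContainsCopy G (Function.update y e true) ψ ∧ CoversEdge G ψ e then (1 : ℝ) else 0)
      = ∑ ψ : Fin m ↪ Fin n, if (ContainsCopy G (Function.update z e true) ψ ∧
        ¬ ContainsCopy G (Function.update y e true) ψ) ∧ CoversEdge G ψ e then (1 : ℝ) else 0 := by
    intro e
    rw [← Finset.sum_sub_distrib]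
    refine Finset.sum_congr rfl fun ψ _ => ?_
    have : ContainsCopy G (Function.update y e true) ψ →
        ContainsCopy G (Function.update z e true) ψ := fun h => h.mono (update_true_mono hyz e)
    by_cases h1 : ContainsCopy G (Function.update y e true) ψ
    · simp [h1, this h1]
    · simp [h1]
  simp only [hL]
  rw [Finset.sum_comm]
  conv_rhs => rw [← Finset.sum_product', Finset.sum_comm]
  refine Finset.sum_le_sum fun ψ _ => ?_
  rw [Finset.sum_boole, Finset.sum_boole]
  have hsub : (({e | (ContainsCopy G (Function.update z e true) ψ ∧
        ¬ ContainsCopy G (Function.update y e true) ψ) ∧ CoversEdge G ψ e} :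
          Finset (EdgeSet n)).image Subtype.val) ⊆
      ((G.edgeSet.toFinset ×ˢ ({f | y f ≠ z f} : Finset (EdgeSet n))).filter fun q =>
        ContainsCopy (G.deleteEdges {q.1}) (Function.update z q.2 true) ψ ∧
          CoversEdge (G.deleteEdges {q.1}) ψ q.2).image fun q => q.1.map ψ := by
    intro e' he'
    simp only [Finset.mem_image, Finset.mem_filter, Finset.mem_univ, true_and] at he'
    obtain ⟨e, ⟨⟨hz, hy⟩, g, hg, hge⟩, rfl⟩ := he'
    unfold ContainsCopy at hy
    push Not at hy
    obtain ⟨k, hk, hky⟩ := hy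
    obtain ⟨hkd, hkz⟩ := hz k hk
    have hky := hky hkd
    have hne : (⟨k.map ψ, hkd⟩ : EdgeSet n) ≠ e := by
      rintro h
      simp [h] at hky
    rw [Function.update_of_ne hne] at hky hkz
    have hkg : k ≠ g := by
      rintro rfl
      exact hne (Subtype.ext hge)
    simp only [Finset.mem_image, Finset.mem_filter, Finset.mem_product, Finset.mem_univ, true_and,
      Set.mem_toFinset]
    refine ⟨(g, ⟨k.map ψ, hkd⟩), ⟨⟨hg, by rw [hkz]; exact hky⟩, ?_, ?_⟩, hge⟩
    · intro l hl
      rw [SimpleGraph.edgeSet_deleteEdges] at hl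
      obtain ⟨hld, hlz⟩ := hz l hl.1
      refine ⟨hld, ?_⟩
      have : (⟨l.map ψ, hld⟩ : EdgeSet n) ≠ e := by
        intro h
        exact hl.2 (Sym2.map.injective ψ.injective ((congrArg Subtype.val h).trans hge.symm))
      rw [Function.update_of_ne this] at hlz
      exact Bool.eq_true_of_true_le (by
        rw [← hlz]
        by_cases h : (⟨l.map ψ, hld⟩ : EdgeSet n) = ⟨k.map ψ, hkd⟩
        · rw [h]; simp
        · simp [h])
    · exact ⟨k, by rw [SimpleGraph.edgeSet_deleteEdges]; exact ⟨hk, hkg⟩, rfl⟩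
  have hcard := Finset.card_le_card hsub
  rw [Finset.card_image_of_injective _ Subtype.val_injective] at hcard
  exact_mod_cast hcard.trans Finset.card_image_le

lemma exists_perm_map_eq {n : ℕ} (e f : EdgeSet n) :
    ∃ σ : Equiv.Perm (Fin n), e.1.map σ = f.1 := by
  obtain ⟨e, he⟩ := e
  obtain ⟨f, hf⟩ := f
  induction e using Sym2.ind with
  | _ u v =>
    induction f using Sym2.ind with
    | _ u' v' =>
      rw [Sym2.mk_isDiag_iff] at he hf
      refine ⟨Equiv.swap (Equiv.swap u u' v) v' * Equiv.swap u u', ?_⟩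
      have h : u' ≠ Equiv.swap u u' v := fun h => he (by
        have := congrArg (Equiv.swap u u') h
        simpa using this)
      simp [Equiv.swap_apply_of_ne_of_ne h hf]

/-- The number of embeddings of the vertices of a graph with a single edge sending this edge
onto `e`. -/
lemma NGe_eq_of_numEdges_eq_one {n m : ℕ} (hn : 2 ≤ n) (G : SimpleGraph (Fin m))
    (hG : numEdges G = 1) (x : Config n) (e : EdgeSet n) :
    2 ≤ m ∧ NGe G x e = 2 * ((n - 2).descFactorial (m - 2) : ℝ) := by
  classical
  obtain ⟨g, hg⟩ := Set.ncard_eq_one.mp hG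
  have hgG : g ∈ G.edgeSet := by rw [hg]; rfl
  have hgd : ¬ g.IsDiag := G.not_isDiag_of_mem_edgeSet hgG
  have hm : 2 ≤ m := by
    induction g using Sym2.ind with
    | _ a b =>
      rw [Sym2.mk_isDiag_iff] at hgd
      have := a.2
      have := b.2
      by_contra hlt
      exact hgd (Fin.ext (by omega))
  refine ⟨hm, ?_⟩
  have hcount (e : EdgeSet n) :
      NGe G x e = ∑ ψ : Fin m ↪ Fin n, if g.map ψ = e.1 then (1 : ℝ) else 0 := by
    rw [NGe_eq_sum]
    refine Finset.sum_congr rfl fun ψ _ => ?_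
    congr 1
    simp only [CoversEdge, ContainsCopy, hg, Set.mem_singleton_iff, exists_eq_left, eq_iff_iff,
      forall_eq, and_iff_right_iff_imp]
    intro h
    have h' : ¬ (g.map ψ).IsDiag := by rw [h]; exact e.2
    have : (⟨g.map ψ, h'⟩ : EdgeSet n) = e := Subtype.ext h
    exact ⟨h', by rw [this]; simp⟩
  have hconst (f : EdgeSet n) : NGe G x f = NGe G x e := by
    rw [hcount, hcount]
    obtain ⟨σ, hσ⟩ := exists_perm_map_eq f e
    refine Fintype.sum_equiv (Equiv.embeddingCongr (Equiv.refl _) σ) _ _ fun ψ => ?_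
    have : g.map (Equiv.embeddingCongr (Equiv.refl (Fin m)) σ ψ) = (g.map ψ).map σ := by
      rw [Sym2.map_map]
      rfl
    simp only [this, ← hσ, (Sym2.map.injective σ.injective).eq_iff]
  have htotal : ∑ f : EdgeSet n, NGe G x f = n.descFactorial m := by
    simp only [hcount]
    rw [Finset.sum_comm]
    have (ψ : Fin m ↪ Fin n) :
        ∑ f : EdgeSet n, (if g.map ψ = f.1 then (1 : ℝ) else 0) = 1 := by
      have hd : ¬ (g.map ψ).IsDiag := by
        rwa [Sym2.isDiag_map ψ.injective]
      rw [Finset.sum_eq_single (⟨g.map ψ, hd⟩ : EdgeSet n)]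
      · simp
      · intro f _ hf
        exact if_neg fun h => hf (Subtype.ext h.symm)
      · simp
    simp [this, Fintype.card_embedding_eq]
  simp only [hconst, Finset.sum_const, Finset.card_univ, nsmul_eq_mul] at htotal
  rw [Sym2.card_subtype_not_diag, Fintype.card_fin] at htotal
  obtain ⟨k, rfl⟩ : ∃ k, n = k + 2 := ⟨n - 2, by omega⟩
  obtain ⟨j, rfl⟩ : ∃ j, m = j + 2 := ⟨m - 2, by omega⟩
  rw [Nat.cast_choose_two, Nat.succ_descFactorial_succ, Nat.succ_descFactorial_succ] at htotal
  push_cast at htotal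
  simp only [Nat.add_sub_cancel]
  have hk : (0 : ℝ) < (k + 2) * (k + 1) := by positivity
  refine mul_left_cancel₀ hk.ne' ?_
  linear_combination 2 * htotal

lemma NGe_eq_zero_of_numEdges_eq_zero {n m : ℕ} (G : SimpleGraph (Fin m))
    (hG : numEdges G = 0) (x : Config n) (e : EdgeSet n) : NGe G x e = 0 := by
  have hE : G.edgeSet = ∅ := (Set.ncard_eq_zero (Set.toFinite _)).mp hG
  simp [NGe_eq_sum, CoversEdge, hE]

lemma rG_nonneg {n m : ℕ} (G : SimpleGraph (Fin m)) (x : Config n) (e : EdgeSet n) :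
    0 ≤ rG G x e :=
  Real.rpow_nonneg (div_nonneg (NGe_nonneg G x e) (by positivity)) _

lemma NGe_div_eq_rG_pow {n m : ℕ} (G : SimpleGraph (Fin m)) (hG : 2 ≤ numEdges G)
    (x : Config n) (e : EdgeSet n) :
    NGe G x e / (n : ℝ) ^ (m - 2) = 2 * numEdges G * rG G x e ^ (numEdges G - 1) := by
  have hE : (0 : ℝ) < numEdges G := by exact_mod_cast (by omega : 0 < numEdges G)
  have hcast : ((numEdges G : ℝ) - 1) = ((numEdges G - 1 : ℕ) : ℝ) := by
    rw [Nat.cast_sub (by omega)]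
    simp
  rw [rG, hcast, one_div, Real.rpow_inv_natCast_pow
    (div_nonneg (NGe_nonneg G x e) (by positivity)) (by omega)]
  rw [mul_div_assoc', mul_comm (2 * (numEdges G : ℝ)) (NGe G x e), mul_comm (2 * (numEdges G : ℝ)),
    mul_div_mul_right _ _ (by positivity)]

lemma NGe_div_le {n m a : ℕ} (hn : 2 ≤ n) {p δ : ℝ} {x : Config n} (hx : memT a p δ x)
    (hm : m ≤ a) (G : SimpleGraph (Fin m)) (e : EdgeSet n) :
    NGe G x e / (n : ℝ) ^ (m - 2) ≤ 2 * numEdges G * (p + δ) ^ (numEdges G - 1) := by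
  rcases Nat.lt_or_ge (numEdges G) 2 with h | h
  · interval_cases hE : numEdges G
    · simp [NGe_eq_zero_of_numEdges_eq_zero G hE x e]
    · rw [(NGe_eq_of_numEdges_eq_one hn G hE x e).2]
      have hn0 : (0 : ℝ) < n := by exact_mod_cast (by omega : 0 < n)
      rw [div_le_iff₀ (by positivity)]
      have : ((n - 2).descFactorial (m - 2) : ℝ) ≤ (n : ℝ) ^ (m - 2) := by
        exact_mod_cast (Nat.descFactorial_le_pow _ _).trans
          (Nat.pow_le_pow_left (Nat.sub_le n 2) _)
      simpa using this
  · rw [NGe_div_eq_rG_pow G h]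
    have := rG_nonneg G x e
    gcongr
    exact (hx m hm G h e).2.le

lemma tendsto_descFactorial_sub_two_div_pow (k : ℕ) :
    Tendsto (fun n : ℕ => ((n - 2).descFactorial k : ℝ) / (n : ℝ) ^ k) atTop (nhds 1) := by
  have hlow : Tendsto (fun n : ℕ => (1 - (k + 1 : ℝ) / n) ^ k) atTop (nhds 1) := by
    simpa using ((tendsto_const_nhds (x := (1 : ℝ))).sub
      (tendsto_const_div_atTop_nhds_zero_nat (k + 1 : ℝ))).pow k
  refine tendsto_of_tendsto_of_tendsto_of_le_of_le' hlow tendsto_const_nhds ?_ ?_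
  · filter_upwards [eventually_ge_atTop (k + 3)] with n hn
    have hn0 : (0 : ℝ) < n := by exact_mod_cast (by omega : 0 < n)
    have h := Nat.pow_sub_le_descFactorial (n - 2) k
    rw [show n - 2 + 1 - k = n - (k + 1) by omega] at h
    rw [one_sub_div hn0.ne', div_pow]
    gcongr
    have h' : (((n - (k + 1) : ℕ) : ℝ)) ^ k ≤ ((n - 2).descFactorial k : ℝ) := by exact_mod_cast h
    rwa [Nat.cast_sub (by omega), Nat.cast_add, Nat.cast_one] at h'
  · filter_upwards [eventually_ge_atTop 1] with n hn
    have hn0 : (0 : ℝ) < n := by exact_mod_cast hn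
    rw [div_le_one (by positivity)]
    exact_mod_cast (Nat.descFactorial_le_pow _ _).trans (Nat.pow_le_pow_left (Nat.sub_le n 2) _)

lemma eventually_le_NGe_div {m a : ℕ} {p δ ε : ℝ} (hδ : δ ≤ p) (hε : 0 < ε) (hm : m ≤ a)
    (G : SimpleGraph (Fin m)) :
    ∀ᶠ n : ℕ in atTop, ∀ x : Config n, memT a p δ x → ∀ e : EdgeSet n,
      2 * numEdges G * (p - δ) ^ (numEdges G - 1) - ε ≤ NGe G x e / (n : ℝ) ^ (m - 2) := by
  rcases Nat.lt_or_ge (numEdges G) 2 with h | h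
  · interval_cases hE : numEdges G
    · refine Eventually.of_forall fun n x _ e => ?_
      simp [NGe_eq_zero_of_numEdges_eq_zero G hE x e, hε.le]
    · have ht := (tendsto_descFactorial_sub_two_div_pow (m - 2)).const_mul 2
      filter_upwards [ht.eventually_const_le (show 2 * 1 - ε < 2 * 1 by linarith),
        eventually_ge_atTop 2] with n h1 hn x _ e
      rw [(NGe_eq_of_numEdges_eq_one hn G hE x e).2, mul_div_assoc]
      simpa using h1
  · refine Eventually.of_forall fun n x hx e => ?_
    rw [NGe_div_eq_rG_pow G h]
    have hr := (hx m hm G h e).1.le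
    have hp : 0 ≤ p - δ := by linarith
    have : 2 * numEdges G * (p - δ) ^ (numEdges G - 1) ≤
      2 * numEdges G * rG G x e ^ (numEdges G - 1) := by gcongr
    linarith

lemma dHam_le {n s a : ℕ} (hn : 2 ≤ n) (V : Fin s → ℕ) (G : ∀ i, SimpleGraph (Fin (V i)))
    {β : Fin s → ℝ} (hβ : ∀ i, 0 < β i) (ha : ∀ i, V i ≤ a) {p δ : ℝ} {x : Config n}
    (hx : memT a p δ x) (e : EdgeSet n) : dHam V G β e x ≤ Psi V G β (p + δ) := by
  rw [dHam_eq_sum, Psi]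
  refine Finset.sum_le_sum fun i _ => ?_
  have := mul_le_mul_of_nonneg_left (NGe_div_le hn hx (ha i) (G i) e) (hβ i).le
  linarith

lemma eventually_le_dHam {s a : ℕ} (V : Fin s → ℕ) (G : ∀ i, SimpleGraph (Fin (V i)))
    {β : Fin s → ℝ} (hβ : ∀ i, 0 < β i) (ha : ∀ i, V i ≤ a) {p δ ε : ℝ} (hδ : δ ≤ p)
    (hε : 0 < ε) :
    ∀ᶠ n : ℕ in atTop, ∀ x : Config n, memT a p δ x → ∀ e : EdgeSet n,
      Psi V G β (p - δ) - ε ≤ dHam V G β e x := by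
  have hB : 0 ≤ ∑ i, β i := Finset.sum_nonneg fun i _ => (hβ i).le
  have hε' : 0 < ε / (1 + ∑ i, β i) := by positivity
  filter_upwards [eventually_all.mpr fun i => eventually_le_NGe_div hδ hε' (ha i) (G i)]
    with n h x hx e
  have hsum : ∑ i, β i * (2 * numEdges (G i) * (p - δ) ^ (numEdges (G i) - 1)
      - ε / (1 + ∑ i, β i)) ≤ dHam V G β e x := by
    rw [dHam_eq_sum]
    exact Finset.sum_le_sum fun i _ => mul_le_mul_of_nonneg_left (h i x hx e) (hβ i).le
  have heq : ∑ i, β i * (2 * numEdges (G i) * (p - δ) ^ (numEdges (G i) - 1)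
      - ε / (1 + ∑ i, β i)) = Psi V G β (p - δ) - (∑ i, β i) * (ε / (1 + ∑ i, β i)) := by
    rw [Psi, Finset.sum_mul, ← Finset.sum_sub_distrib]
    exact Finset.sum_congr rfl fun i _ => by ring
  have hle : (∑ i, β i) * (ε / (1 + ∑ i, β i)) ≤ ε := by
    rw [mul_div_assoc', div_le_iff₀ (by positivity)]
    nlinarith
  linarith

lemma dHam_mono {n s : ℕ} (V : Fin s → ℕ) (G : ∀ i, SimpleGraph (Fin (V i)))
    {β : Fin s → ℝ} (hβ : ∀ i, 0 < β i) {y z : Config n} (hyz : ∀ e, y e ≤ z e)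
    (e : EdgeSet n) : dHam V G β e y ≤ dHam V G β e z := by
  rw [dHam_eq_sum, dHam_eq_sum]
  refine Finset.sum_le_sum fun i _ => mul_le_mul_of_nonneg_left ?_ (hβ i).le
  have := NGe_mono (G i) hyz e
  gcongr

/-- The derivative of `Psi V G β` at `p`. -/
noncomputable def dPsi {s : ℕ} (V : Fin s → ℕ) (G : ∀ i, SimpleGraph (Fin (V i)))
    (β : Fin s → ℝ) (p : ℝ) : ℝ :=
  ∑ i, 2 * β i * (numEdges (G i) : ℝ) *
    (((numEdges (G i) - 1 : ℕ) : ℝ) * p ^ (numEdges (G i) - 1 - 1))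

lemma hasDerivAt_Psi {s : ℕ} (V : Fin s → ℕ) (G : ∀ i, SimpleGraph (Fin (V i)))
    (β : Fin s → ℝ) (p : ℝ) : HasDerivAt (Psi V G β) (dPsi V G β p) p :=
  HasDerivAt.fun_sum fun i _ => (hasDerivAt_pow (numEdges (G i) - 1) p).const_mul _

lemma continuous_Psi {s : ℕ} (V : Fin s → ℕ) (G : ∀ i, SimpleGraph (Fin (V i)))
    (β : Fin s → ℝ) : Continuous (Psi V G β) := by
  unfold Psi
  fun_prop

lemma continuous_dPsi {s : ℕ} (V : Fin s → ℕ) (G : ∀ i, SimpleGraph (Fin (V i)))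
    (β : Fin s → ℝ) : Continuous (dPsi V G β) := by
  unfold dPsi
  fun_prop

lemma sum_dHam_sub_le {n s a : ℕ} (hn : 2 ≤ n) (V : Fin s → ℕ)
    (G : ∀ i, SimpleGraph (Fin (V i))) {β : Fin s → ℝ} (hβ : ∀ i, 0 < β i)
    (ha : ∀ i, V i ≤ a) {p δ : ℝ} {y z : Config n} (hyz : ∀ e, y e ≤ z e)
    (hz : memT a p δ z) :
    ∑ e, (dHam V G β e z - dHam V G β e y) ≤ dPsi V G β (p + δ) * hammingDist y z := by
  classical
  have hn0 : (0 : ℝ) < n := by exact_mod_cast (by omega : 0 < n)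
  simp only [dHam_eq_sum, ← Finset.sum_sub_distrib]
  rw [Finset.sum_comm, dPsi, Finset.sum_mul]
  refine Finset.sum_le_sum fun i _ => ?_
  have hG := sum_NGe_sub_le (G i) hyz
  have hbound : ∑ g ∈ (G i).edgeSet.toFinset, ∑ f with y f ≠ z f, NGe ((G i).deleteEdges {g}) z f
      ≤ (numEdges (G i)) * (hammingDist y z * (2 * (numEdges (G i) - 1 : ℕ) *
        (p + δ) ^ (numEdges (G i) - 1 - 1) * (n : ℝ) ^ (V i - 2))) := by
    have hcard : ((G i).edgeSet.toFinset).card = numEdges (G i) :=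
      (Set.ncard_eq_toFinset_card' _).symm
    refine (Finset.sum_le_card_nsmul _ _ _ fun g hg => ?_).trans_eq
      (by rw [hcard, nsmul_eq_mul])
    have hdist : hammingDist y z = #{f | y f ≠ z f} := by rw [hammingDist]
    rw [hdist, ← nsmul_eq_mul]
    refine Finset.sum_le_card_nsmul _ _ _ fun f _ => ?_
    have := NGe_div_le hn hz (ha i) ((G i).deleteEdges {g}) f
    rw [numEdges_deleteEdges_singleton _ (Set.mem_toFinset.mp hg),
      div_le_iff₀ (by positivity)] at this
    exact this
  calc ∑ e, (β i * (NGe (G i) z e / (n : ℝ) ^ (V i - 2))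
        - β i * (NGe (G i) y e / (n : ℝ) ^ (V i - 2)))
      = β i / (n : ℝ) ^ (V i - 2) * ∑ e, (NGe (G i) z e - NGe (G i) y e) := by
        rw [Finset.mul_sum]
        exact Finset.sum_congr rfl fun e _ => by ring
    _ ≤ β i / (n : ℝ) ^ (V i - 2) * ((numEdges (G i)) * (hammingDist y z *
        (2 * (numEdges (G i) - 1 : ℕ) * (p + δ) ^ (numEdges (G i) - 1 - 1)
          * (n : ℝ) ^ (V i - 2)))) :=
        mul_le_mul_of_nonneg_left (hG.trans hbound) (div_nonneg (hβ i).le (by positivity))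
    _ = _ := by
        field_simp

lemma Phi_pos (u : ℝ) : 0 < Phi u := by unfold Phi; positivity

lemma Phi_lt_one (u : ℝ) : Phi u < 1 := by
  unfold Phi
  rw [div_lt_one (by positivity)]
  linarith

lemma hasDerivAt_Phi (u : ℝ) : HasDerivAt Phi (Phi u * (1 - Phi u)) u := by
  have h : (1 + Real.exp u) ≠ 0 := by positivity
  refine ((Real.hasDerivAt_exp u).div ((Real.hasDerivAt_exp u).const_add 1) h).congr_deriv ?_
  unfold Phi
  field_simp

lemma continuous_Phi : Continuous Phi :=
  continuous_iff_continuousAt.mpr fun u => (hasDerivAt_Phi u).continuousAt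

lemma monotone_Phi : Monotone Phi :=
  monotone_of_hasDerivAt_nonneg hasDerivAt_Phi fun u =>
    mul_nonneg (Phi_pos u).le (sub_nonneg.mpr (Phi_lt_one u).le)

lemma Phi_sub_le {u₀ η K : ℝ} (hK : ∀ u, |u - u₀| < η → Phi u * (1 - Phi u) ≤ K) {u v : ℝ}
    (huv : u ≤ v) (hu : |u - u₀| < η) (hv : |v - u₀| < η) : Phi v - Phi u ≤ K * (v - u) := by
  refine (convex_ball u₀ η).image_sub_le_mul_sub_of_deriv_le continuous_Phi.continuousOn
    (fun x _ => (hasDerivAt_Phi x).differentiableAt.differentiableWithinAt) (fun x hx => ?_)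
    u ?_ v ?_ huv
  · rw [(hasDerivAt_Phi x).deriv]
    refine hK x ?_
    have := interior_subset hx
    rwa [Metric.mem_ball, Real.dist_eq] at this
  · rwa [Metric.mem_ball, Real.dist_eq]
  · rwa [Metric.mem_ball, Real.dist_eq]

lemma Subcritical.exists_contraction_constants {s : ℕ} {V : Fin s → ℕ}
    {G : ∀ i, SimpleGraph (Fin (V i))} {β : Fin s → ℝ} {p : ℝ} (h : Subcritical V G β p) :
    ∃ δ η K : ℝ, 0 < δ ∧ δ < p ∧ 0 < η ∧ 0 ≤ K ∧
      (∀ u, |u - Psi V G β p| < η → Phi u * (1 - Phi u) ≤ K) ∧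
      Psi V G β (p + δ) < Psi V G β p + η ∧ Psi V G β p - η / 2 < Psi V G β (p - δ) ∧
      K * dPsi V G β (p + δ) < 1 - δ := by
  obtain ⟨hfix, -, hderiv⟩ := h
  have hp : 0 < p := hfix ▸ Phi_pos _
  set u₀ := Psi V G β p
  set L := Phi u₀ * (1 - Phi u₀)
  have hLpos : 0 < L := mul_pos (Phi_pos _) (sub_pos.mpr (Phi_lt_one _))
  have hL1 : L * dPsi V G β p < 1 := by
    have hd : HasDerivAt (phiFn V G β) (L * dPsi V G β p) p :=
      (hasDerivAt_Phi u₀).comp p (hasDerivAt_Psi V G β p)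
    rwa [hd.deriv] at hderiv
  obtain ⟨K, hLK, hK⟩ : ∃ K, L < K ∧ K * dPsi V G β p < 1 := by
    have hc : Continuous fun K : ℝ => K * dPsi V G β p := by fun_prop
    have hlt : ∀ᶠ K in nhds L, K * dPsi V G β p < 1 :=
      (hc.tendsto L).eventually_lt_const hL1
    obtain ⟨K, h1, h2⟩ := ((hlt.filter_mono nhdsWithin_le_nhds).and
      (self_mem_nhdsWithin (s := Set.Ioi L))).exists
    exact ⟨K, h2, h1⟩
  have hcΦ : Continuous fun u => Phi u * (1 - Phi u) :=
    continuous_Phi.mul (continuous_const.sub continuous_Phi)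
  obtain ⟨η, hη, hηK⟩ := Metric.eventually_nhds_iff.mp ((hcΦ.tendsto u₀).eventually_le_const hLK)
  have hc1 : Continuous fun δ => Psi V G β (p + δ) :=
    (continuous_Psi V G β).comp (by fun_prop)
  have hc2 : Continuous fun δ => Psi V G β (p - δ) :=
    (continuous_Psi V G β).comp (by fun_prop)
  have hc3 : Continuous fun δ => K * dPsi V G β (p + δ) + δ :=
    (continuous_const.mul ((continuous_dPsi V G β).comp (by fun_prop))).add continuous_id
  have e1 : ∀ᶠ δ in nhds (0 : ℝ), Psi V G β (p + δ) < u₀ + η :=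
    (hc1.tendsto 0).eventually_lt_const (by simp only [add_zero]; linarith)
  have e2 : ∀ᶠ δ in nhds (0 : ℝ), u₀ - η / 2 < Psi V G β (p - δ) :=
    (hc2.tendsto 0).eventually_const_lt (by simp only [sub_zero]; linarith)
  have e3 : ∀ᶠ δ in nhds (0 : ℝ), K * dPsi V G β (p + δ) + δ < 1 :=
    (hc3.tendsto 0).eventually_lt_const (by simpa using hK)
  have e4 : ∀ᶠ δ in nhds (0 : ℝ), δ < p := eventually_lt_nhds hp
  obtain ⟨δ, ⟨h1, h2, h3, h4⟩, h5⟩ :=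
    (((e1.and (e2.and (e3.and e4))).filter_mono nhdsWithin_le_nhds).and
      (self_mem_nhdsWithin (s := Set.Ioi (0 : ℝ)))).exists
  refine ⟨δ, η, K, h5, h4, hη, (hLpos.trans hLK).le, fun u hu => hηK ?_, h1, h2, by linarith⟩
  rwa [Real.dist_eq]

lemma hammingDist_update_s13 {ι α : Type*} [Fintype ι] [DecidableEq ι] [DecidableEq α]
    (y z : ι → α) (e : ι) (b c : α) :
    (hammingDist (Function.update y e b) (Function.update z e c) : ℝ) =
      hammingDist y z - (if y e ≠ z e then 1 else 0) + (if b ≠ c then 1 else 0) := by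
  have h (u v : ι → α) : (hammingDist u v : ℝ) =
      (if u e ≠ v e then 1 else 0) +
        ∑ i ∈ Finset.univ.erase e, if u i ≠ v i then (1 : ℝ) else 0 := by
    rw [Finset.add_sum_erase _ (fun i => if u i ≠ v i then (1 : ℝ) else 0) (Finset.mem_univ e),
      hammingDist, Finset.sum_boole]
  rw [h, h y z]
  simp only [Function.update_self]
  have : ∑ i ∈ Finset.univ.erase e, (if Function.update y e b i ≠ Function.update z e c i
      then (1 : ℝ) else 0) = ∑ i ∈ Finset.univ.erase e, if y i ≠ z i then (1 : ℝ) else 0 := by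
    refine Finset.sum_congr rfl fun i hi => ?_
    rw [Function.update_of_ne (Finset.ne_of_mem_erase hi),
      Function.update_of_ne (Finset.ne_of_mem_erase hi)]
  rw [this]
  ring

lemma hammingDist_gcStep {n s : ℕ} (V : Fin s → ℕ) (G : ∀ i, SimpleGraph (Fin (V i)))
    (β : Fin s → ℝ) {y z : Config n} (hyz : ∀ e, dHam V G β e y ≤ dHam V G β e z)
    (e : EdgeSet n) (u : ℝ) :
    (hammingDist (gcStep V G β (e, u) y) (gcStep V G β (e, u) z) : ℝ) =
      hammingDist y z - (if y e ≠ z e then 1 else 0) +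
        (Set.Ioc (Phi (dHam V G β e y)) (Phi (dHam V G β e z))).indicator 1 u := by
  have hle := monotone_Phi (hyz e)
  rw [gcStep, gcStep, hammingDist_update_s13]
  congr 1
  by_cases h1 : u ≤ Phi (dHam V G β e y)
  · have h2 := h1.trans hle
    simp [h1, h2]
  · by_cases h2 : u ≤ Phi (dHam V G β e z)
    · rw [Set.indicator_of_mem (Set.mem_Ioc.mpr ⟨lt_of_not_ge h1, h2⟩)]
      simp [h1, h2]
    · simp [h1, h2]

lemma integral_seed {n : ℕ} (hn : 2 ≤ n) {F : EdgeSet n × ℝ → ℝ} (hF : Measurable F)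
    {C : ℝ} (hC : ∀ ω, ‖F ω‖ ≤ C) :
    ∫ ω, F ω ∂(seed n) =
      (Fintype.card (EdgeSet n) : ℝ)⁻¹ * ∑ e, ∫ u in Set.Ioc (0 : ℝ) 1, F (e, u) := by
  have hM : (Fintype.card (EdgeSet n) : ℝ≥0∞) ≠ 0 := by
    rw [Sym2.card_subtype_not_diag, Fintype.card_fin, Nat.cast_ne_zero]
    exact (Nat.choose_pos hn).ne'
  have : IsFiniteMeasure ((Fintype.card (EdgeSet n) : ℝ≥0∞)⁻¹ •
      (Measure.count : Measure (EdgeSet n))) :=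
    Measure.smul_finite _ (ENNReal.inv_ne_top.mpr hM)
  rw [seed, integral_prod _ (Integrable.of_bound hF.aestronglyMeasurable C
    (Eventually.of_forall hC)), integral_smul_measure, integral_count,
    ENNReal.toReal_inv, ENNReal.toReal_natCast, smul_eq_mul]

lemma integral_hammingDist_gcStep {n s : ℕ} (hn : 2 ≤ n) (V : Fin s → ℕ)
    (G : ∀ i, SimpleGraph (Fin (V i))) (β : Fin s → ℝ) {y z : Config n}
    (hyz : ∀ e, dHam V G β e y ≤ dHam V G β e z) :
    ∫ ω : EdgeSet n × ℝ, (hammingDist (gcStep V G β ω y) (gcStep V G β ω z) : ℝ) ∂(seed n) =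
      (Fintype.card (EdgeSet n) : ℝ)⁻¹ * ∑ e, (hammingDist y z - (if y e ≠ z e then 1 else 0) +
        (Phi (dHam V G β e z) - Phi (dHam V G β e y))) := by
  rw [integral_seed hn (C := Fintype.card (EdgeSet n))]
  · congr 1
    refine Finset.sum_congr rfl fun e _ => ?_
    simp only [hammingDist_gcStep V G β hyz]
    have hle := monotone_Phi (hyz e)
    have hsub : Set.Ioc (Phi (dHam V G β e y)) (Phi (dHam V G β e z)) ⊆ Set.Ioc (0 : ℝ) 1 :=
      Set.Ioc_subset_Ioc (Phi_pos _).le (Phi_lt_one _).le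
    have hint : Integrable ((Set.Ioc (Phi (dHam V G β e y)) (Phi (dHam V G β e z))).indicator
        (1 : ℝ → ℝ)) (volume.restrict (Set.Ioc (0 : ℝ) 1)) :=
      (integrable_const (1 : ℝ)).indicator measurableSet_Ioc
    rw [integral_add (integrable_const _) hint, integral_indicator_one measurableSet_Ioc]
    simp [measureReal_restrict_apply, Set.inter_eq_left.mpr hsub, hle]
  · refine measurable_from_prod_countable_right fun e => ?_
    simp only [hammingDist_gcStep V G β hyz]
    exact measurable_const.add (measurable_one.indicator measurableSet_Ioc)
  · intro ω
    rw [Real.norm_natCast]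
    exact_mod_cast hammingDist_le_card_fintype

/-- **(Equation (224): one-step Hamming contraction on `T_δ`).**
If `β` is sub-critical, there is a small `δ > 0` such that for all sufficiently
large `n` and all `y ≤ z` with `y, z ∈ T_δ`, under the grand coupling
`𝔼[d_H(Z^y(1), Z^z(1))] ≤ (1 - δ/M) d_H(y,z)`. -/
theorem one_step_contraction_on_T {s : ℕ} (V : Fin s → ℕ)
    (G : ∀ i, SimpleGraph (Fin (V i))) (β : Fin s → ℝ) (hβ : ∀ i, 0 < β i)
    (p : ℝ) (hsub : Subcritical V G β p) (a : ℕ) (ha : ∀ i, V i ≤ a) :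
    ∃ δ : ℝ, 0 < δ ∧ ∃ N : ℕ, ∀ n : ℕ, N ≤ n →
      ∀ y z : Config n, (∀ e, y e ≤ z e) → memT a p δ y → memT a p δ z →
        (∫ ω : EdgeSet n × ℝ,
            (hammingDist (gcStep V G β ω y) (gcStep V G β ω z) : ℝ) ∂(seed n)) ≤
          (1 - δ / (Fintype.card (EdgeSet n) : ℝ)) * (hammingDist y z : ℝ) := by
  classical
  obtain ⟨δ, η, K, hδ, hδp, hη, hK0, hK, hup, hlow, hcontr⟩ := hsub.exists_contraction_constants
  obtain ⟨N, hN⟩ := eventually_atTop.mp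
    (eventually_le_dHam V G hβ ha hδp.le (half_pos hη))
  refine ⟨δ, hδ, max N 2, fun n hn y z hyz hy hz => ?_⟩
  have hn2 : 2 ≤ n := (le_max_right _ _).trans hn
  have hnN : N ≤ n := (le_max_left _ _).trans hn
  have hmono := dHam_mono V G hβ hyz
  have hball {x : Config n} (hx : memT a p δ x) (e : EdgeSet n) :
      |dHam V G β e x - Psi V G β p| < η := by
    have h1 := dHam_le hn2 V G hβ ha hx e
    have h2 := hN n hnN x hx e
    rw [abs_sub_lt_iff]
    constructor <;> linarith
  rw [integral_hammingDist_gcStep hn2 V G β hmono]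
  have hM : (0 : ℝ) < Fintype.card (EdgeSet n) := by
    rw [Sym2.card_subtype_not_diag, Fintype.card_fin]
    exact_mod_cast Nat.choose_pos hn2
  have hd : ∑ e : EdgeSet n, (if y e ≠ z e then (1 : ℝ) else 0) = hammingDist y z := by
    rw [hammingDist, Finset.sum_boole]
  have hPhi : ∑ e, (Phi (dHam V G β e z) - Phi (dHam V G β e y)) ≤
      (1 - δ) * hammingDist y z := by
    calc ∑ e, (Phi (dHam V G β e z) - Phi (dHam V G β e y))
        ≤ ∑ e, K * (dHam V G β e z - dHam V G β e y) :=
          Finset.sum_le_sum fun e _ => Phi_sub_le hK (hmono e) (hball hy e) (hball hz e)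
      _ = K * ∑ e, (dHam V G β e z - dHam V G β e y) := by rw [Finset.mul_sum]
      _ ≤ K * (dPsi V G β (p + δ) * hammingDist y z) :=
          mul_le_mul_of_nonneg_left (sum_dHam_sub_le hn2 V G hβ ha hyz hz) hK0
      _ = K * dPsi V G β (p + δ) * hammingDist y z := by ring
      _ ≤ (1 - δ) * hammingDist y z := by gcongr
  rw [Finset.sum_add_distrib, Finset.sum_sub_distrib, hd, Finset.sum_const, Finset.card_univ,
    nsmul_eq_mul, inv_mul_le_iff₀ hM, ← mul_assoc, mul_sub, mul_one, mul_div_cancel₀ _ hM.ne']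
  linarith

end ERGM
end
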